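/- Let μ, α, β, σ > 0 and r ≥ 3 with, in case r = 3, the additional condition 2βμ ≥ 1. There exist constants C, C* > 0, depending only on μ, α, β, σ, r, such that the following holds. Let y : ℝ → ℝ be continuous, let f : ℝ × ℝ³ → ℝ³ be continuous with ∫_{ℝ³}|f(t,x)|² dx < ∞ for every t, let u : ℝ × ℝ³ → ℝ³ be smooth with, for each bounded time interval, a single compact set K ⊂ ℝ³ containing the support of u(t,·) for all t in that interval, let u(t,·) be divergence-free (∑_{i=1}^{3} ∂uᵢ/∂xᵢ ≡ 0) for every t, and let p : ℝ × ℝ³ → ℝ be continuously differentiable in x, such that ∂u/∂t − μΔu + e^{y(t)}(u·∇)u + αu + βe^{(r−1)y(t)}|u|^{r−1}u = −e^{−y(t)}∇p + e^{−y(t)}f + σ y(t) u holds pointwise on ℝ × ℝ³. Then the function G(t) := ∫_{ℝ³}|∇u(t,x)|² dx is differentiable and for every t: G′(t) + (α − 2σ y(t)) G(t) + C* e^{(r−1)y(t)} (∫_{ℝ³}|u(t,x)|^{3(r+1)} dx)^{1/3} ≤ C G(t) + C e^{2|y(t)|} ∫_{ℝ³}|f(t,x)|² dx. -/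

import Mathlib

open MeasureTheory Filter

noncomputable section

/-- ℝ³ as a Euclidean space. -/
abbrev E3 : Type := EuclideanSpace ℝ (Fin 3)

/-- Partial derivative `∂g/∂xᵢ` of a scalar function on ℝ³. -/
def pd (i : Fin 3) (g : E3 → ℝ) (x : E3) : ℝ :=
  fderiv ℝ g x (EuclideanSpace.single i 1)

/-- The Laplacian of a scalar function on ℝ³. -/
def lap (g : E3 → ℝ) (x : E3) : ℝ :=
  ∑ i : Fin 3, pd i (fun y => pd i g y) x

/-- `|∇v|² = ∑_{i,j} (∂vⱼ/∂xᵢ)²` for a vector field on ℝ³. -/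
def gradSq (v : E3 → E3) (x : E3) : ℝ :=
  ∑ i : Fin 3, ∑ j : Fin 3, (pd i (fun y => v y j) x) ^ 2

/-- The directional derivatives of a smooth function commute. -/
lemma fderiv_fderiv_apply_comm {V : Type*} [NormedAddCommGroup V] [NormedSpace ℝ V]
    {h : V → ℝ} (hh : ContDiff ℝ (⊤ : ℕ∞) h) (a b x : V) :
    fderiv ℝ (fun q => fderiv ℝ h q a) x b = fderiv ℝ (fun q => fderiv ℝ h q b) x a := by
  have hd : DifferentiableAt ℝ (fderiv ℝ h) x :=
    ((hh.fderiv_right (m := 1) (by norm_num; exact ENat.LEInfty.out)).differentiable one_ne_zero) x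
  have happ : ∀ c d : V, fderiv ℝ (fun q => fderiv ℝ h q c) x d
      = fderiv ℝ (fderiv ℝ h) x d c := fun c d => by
    rw [fderiv_clm_apply hd (differentiableAt_const c)]
    simp
  rw [happ, happ]
  exact (hh.contDiffAt.isSymmSndFDerivAt (by simpa using ENat.LEInfty.out)).eq b a

lemma contDiff_fderiv_apply_const {V : Type*} [NormedAddCommGroup V] [NormedSpace ℝ V]
    {h : V → ℝ} (hh : ContDiff ℝ (⊤ : ℕ∞) h) (a : V) :
    ContDiff ℝ (⊤ : ℕ∞) (fun q => fderiv ℝ h q a) :=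
  (hh.fderiv_right (m := (⊤ : ℕ∞)) (by simp)).clm_apply contDiff_const

lemma hasDerivAt_slice {V : Type*} [NormedAddCommGroup V] [NormedSpace ℝ V] {F : ℝ × V → ℝ}
    (hF : Differentiable ℝ F) (s : ℝ) (x : V) :
    HasDerivAt (fun s => F (s, x)) (fderiv ℝ F (s, x) (1, 0)) s :=
  (hF (s, x)).hasFDerivAt.comp_hasDerivAt s ((hasDerivAt_id s).prodMk (hasDerivAt_const s x))

/-- If a jointly continuously differentiable `F : ℝ × V → ℝ` is supported, locally uniformly in
the first variable, in a compact set, then `∫ F(s, x) dx` can be differentiated in `s` under the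
integral sign. -/
lemma hasDerivAt_integral_of_contDiff {V : Type*} [NormedAddCommGroup V] [NormedSpace ℝ V]
    [MeasurableSpace V] [BorelSpace V] [FiniteDimensional ℝ V] {m : Measure V}
    [IsFiniteMeasureOnCompacts m] {F : ℝ × V → ℝ} (hF : ContDiff ℝ 1 F) {K : Set V}
    (hK : IsCompact K) {t : ℝ} (hFK : ∀ s ∈ Set.Icc (t - 1) (t + 1), ∀ x ∉ K, F (s, x) = 0) :
    HasDerivAt (fun s => ∫ x, F (s, x) ∂m) (∫ x, fderiv ℝ F (t, x) (1, 0) ∂m) t := by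
  have hF' : Continuous (fun q => fderiv ℝ F q (1, 0)) :=
    (hF.continuous_fderiv one_ne_zero).clm_apply continuous_const
  have hder : ∀ s x, HasDerivAt (fun s => F (s, x)) (fderiv ℝ F (s, x) (1, 0)) s :=
    hasDerivAt_slice (hF.differentiable one_ne_zero)
  obtain ⟨M, hM⟩ := ((isCompact_Icc (a := t - 1) (b := t + 1)).prod hK).exists_bound_of_continuousOn
    hF'.continuousOn
  have hzero : ∀ s ∈ Set.Ioo (t - 1) (t + 1), ∀ x ∉ K, fderiv ℝ F (s, x) (1, 0) = 0 := by
    intro s hs x hx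
    refine (hder s x).unique ((hasDerivAt_const s (0 : ℝ)).congr_of_eventuallyEq ?_)
    filter_upwards [Ioo_mem_nhds hs.1 hs.2] with s' hs'
    exact hFK s' (Set.Ioo_subset_Icc_self hs') x hx
  have ht : t ∈ Set.Icc (t - 1) (t + 1) := by constructor <;> linarith
  refine (hasDerivAt_integral_of_dominated_loc_of_deriv_le (s := Set.Ioo (t - 1) (t + 1))
    (F := fun s x => F (s, x)) (F' := fun s x => fderiv ℝ F (s, x) (1, 0))
    (bound := K.indicator fun _ => M)
    (Ioo_mem_nhds (by linarith) (by linarith)) ?_ ?_ ?_ ?_ ?_ ?_).2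
  · exact .of_forall fun s => (hF.continuous.comp (by fun_prop)).aestronglyMeasurable
  · exact (hF.continuous.comp (by fun_prop)).integrable_of_hasCompactSupport
      (HasCompactSupport.intro hK fun x hx => hFK t ht x hx)
  · exact (hF'.comp (by fun_prop)).aestronglyMeasurable
  · refine .of_forall fun x s hs => ?_
    by_cases hx : x ∈ K
    · simpa [hx] using hM (s, x) ⟨Set.Ioo_subset_Icc_self hs, hx⟩
    · simp [hx, hzero s hs x hx]
  · exact (integrable_indicator_iff hK.measurableSet).2
      (integrableOn_const hK.measure_lt_top.ne)
  · exact .of_forall fun x s _ => hder s x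

lemma ContDiff.pd {g : E3 → ℝ} (hg : ContDiff ℝ (⊤ : ℕ∞) g) (i : Fin 3) :
    ContDiff ℝ (⊤ : ℕ∞) (pd i g) :=
  contDiff_fderiv_apply_const hg _

lemma HasCompactSupport.pd {g : E3 → ℝ} (hg : HasCompactSupport g) (i : Fin 3) :
    HasCompactSupport (pd i g) :=
  hg.fderiv_apply ℝ _

lemma continuous_pd {g : E3 → ℝ} (hg : ContDiff ℝ 1 g) (i : Fin 3) : Continuous (pd i g) :=
  (hg.continuous_fderiv one_ne_zero).clm_apply continuous_const

lemma ContDiff.lap {g : E3 → ℝ} (hg : ContDiff ℝ (⊤ : ℕ∞) g) :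
    ContDiff ℝ (⊤ : ℕ∞) (lap g) :=
  ContDiff.sum fun i _ => (hg.pd i).pd i

lemma HasCompactSupport.lap {g : E3 → ℝ} (hg : HasCompactSupport g) :
    HasCompactSupport (lap g) := by
  refine HasCompactSupport.intro hg.isCompact fun x hx => Finset.sum_eq_zero fun i _ => ?_
  exact image_eq_zero_of_notMem_tsupport fun h =>
    hx (tsupport_fderiv_apply_subset ℝ _ (tsupport_fderiv_apply_subset ℝ _ h))

lemma pd_comm {g : E3 → ℝ} (hg : ContDiff ℝ (⊤ : ℕ∞) g) (i j : Fin 3) (x : E3) :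
    pd i (pd j g) x = pd j (pd i g) x :=
  fderiv_fderiv_apply_comm hg _ _ _

/-- Integration by parts on ℝ³ against a compactly supported function. -/
lemma integral_mul_pd {f g : E3 → ℝ} (hf : ContDiff ℝ 1 f) (hg : ContDiff ℝ 1 g)
    (hgc : HasCompactSupport g) (i : Fin 3) :
    ∫ x, f x * pd i g x = -∫ x, pd i f x * g x :=
  integral_mul_fderiv_eq_neg_fderiv_mul_of_integrable
    (((continuous_pd hf i).mul hg.continuous).integrable_of_hasCompactSupport hgc.mul_left)
    ((hf.continuous.mul (continuous_pd hg i)).integrable_of_hasCompactSupport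
      (hgc.pd i).mul_left)
    ((hf.continuous.mul hg.continuous).integrable_of_hasCompactSupport hgc.mul_left)
    (fun x _ => hf.differentiable one_ne_zero x) (fun x _ => hg.differentiable one_ne_zero x)

/-- Green's identity on ℝ³. -/
lemma integral_mul_lap {f g : E3 → ℝ} (hf : ContDiff ℝ 1 f) (hg : ContDiff ℝ (⊤ : ℕ∞) g)
    (hgc : HasCompactSupport g) :
    ∫ x, f x * lap g x = -∫ x, ∑ i, pd i f x * pd i g x := by
  simp only [lap, Finset.mul_sum]
  rw [integral_finsetSum, integral_finsetSum, ← Finset.sum_neg_distrib]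
  · exact Finset.sum_congr rfl fun i _ =>
      integral_mul_pd hf ((hg.pd i).of_le (by exact_mod_cast le_top)) (hgc.pd i) i
  · exact fun i _ => ((continuous_pd hf i).mul (hg.pd i).continuous).integrable_of_hasCompactSupport
      (hgc.pd i).mul_left
  · exact fun i _ => (hf.continuous.mul ((hg.pd i).pd i).continuous).integrable_of_hasCompactSupport
      ((hgc.pd i).pd i).mul_left

section VectorField

variable {v : E3 → E3}

lemma ContDiff.component {n : WithTop ℕ∞} (hv : ContDiff ℝ n v) (j : Fin 3) :
    ContDiff ℝ n (fun x => v x j) :=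
  (EuclideanSpace.proj (𝕜 := ℝ) j).contDiff.comp hv

lemma HasCompactSupport.component (hv : HasCompactSupport v) (j : Fin 3) :
    HasCompactSupport (fun x => v x j) :=
  hv.comp_left (g := fun z : E3 => z j) rfl

lemma pd_component (hv : Differentiable ℝ v) (i j : Fin 3) (x : E3) :
    pd i (fun y => v y j) x = fderiv ℝ v x (EuclideanSpace.single i 1) j := by
  have h := ((EuclideanSpace.proj (𝕜 := ℝ) j).hasFDerivAt (x := v x)).comp x (hv x).hasFDerivAt
  exact congrArg (fun L : E3 →L[ℝ] ℝ => L (EuclideanSpace.single i 1)) h.fderiv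

lemma pd_norm_rpow (hv : Differentiable ℝ v) {q : ℝ} (hq : 1 < q) (i : Fin 3) (x : E3) :
    pd i (fun y => ‖v y‖ ^ q) x
      = q * ‖v x‖ ^ (q - 2) * ∑ j, v x j * pd i (fun y => v y j) x := by
  have h : fderiv ℝ (fun y => ‖v y‖ ^ q) x = _ :=
    ((hasFDerivAt_norm_rpow (v x) hq).comp x (hv x).hasFDerivAt).fderiv
  rw [pd, h]
  simp [PiLp.inner_apply, pd_component hv, mul_comm]

lemma contDiff_norm_comp_rpow (hv : ContDiff ℝ 1 v) {q : ℝ} (hq : 1 < q) :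
    ContDiff ℝ 1 (fun x => ‖v x‖ ^ q) :=
  (contDiff_norm_rpow hq).comp hv

/-- Green's identity for vector fields on ℝ³. -/
lemma integral_sum_mul_lap (hv : ContDiff ℝ (⊤ : ℕ∞) v) (hvc : HasCompactSupport v)
    {f : Fin 3 → E3 → ℝ} (hf : ∀ j, ContDiff ℝ 1 (f j)) :
    ∫ x, ∑ j, f j x * lap (fun y => v y j) x
      = -∫ x, ∑ i, ∑ j, pd i (f j) x * pd i (fun y => v y j) x := by
  have hL : ∀ j, Integrable (fun x => f j x * lap (fun y => v y j) x) := fun j =>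
    ((hf j).continuous.mul (hv.component j).lap.continuous).integrable_of_hasCompactSupport
      (hvc.component j).lap.mul_left
  have hG : ∀ j i, Integrable (fun x => pd i (f j) x * pd i (fun y => v y j) x) := fun j i =>
    ((continuous_pd (hf j) i).mul ((hv.component j).pd i).continuous).integrable_of_hasCompactSupport
      ((hvc.component j).pd i).mul_left
  simp only [fun x => Finset.sum_comm (s := Finset.univ) (t := Finset.univ)
    (f := fun i j => pd i (f j) x * pd i (fun y => v y j) x)]
  rw [integral_finsetSum _ fun j _ => hL j,
    integral_finsetSum _ fun j _ => integrable_finsetSum _ fun i _ => hG j i,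
    ← Finset.sum_neg_distrib]
  exact Finset.sum_congr rfl fun j _ => integral_mul_lap (hf j) (hv.component j) (hvc.component j)

lemma integral_sum_self_mul_lap (hv : ContDiff ℝ (⊤ : ℕ∞) v) (hvc : HasCompactSupport v) :
    ∫ x, ∑ j, v x j * lap (fun y => v y j) x = -∫ x, gradSq v x := by
  rw [integral_sum_mul_lap hv hvc (f := fun j x => v x j)
    fun j => (hv.component j).of_le (by exact_mod_cast le_top)]
  simp only [gradSq, sq]

/-- A gradient is orthogonal to the Laplacian of a divergence-free field. -/
lemma integral_sum_pd_mul_lap (hv : ContDiff ℝ (⊤ : ℕ∞) v) (hvc : HasCompactSupport v)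
    (hdiv : ∀ x, ∑ i, pd i (fun y => v y i) x = 0) {p : E3 → ℝ} (hp : ContDiff ℝ 1 p) :
    ∫ x, ∑ j, pd j p x * lap (fun y => v y j) x = 0 := by
  have hdivlap : ∀ x, ∑ j, pd j (lap (fun y => v y j)) x = 0 := by
    intro x
    have hpd_sum : ∀ (i : Fin 3) (g : Fin 3 → E3 → ℝ), (∀ k, ContDiff ℝ (⊤ : ℕ∞) (g k)) →
        pd i (fun y => ∑ k, g k y) = fun y => ∑ k, pd i (g k) y := by
      intro i g hg
      ext y
      simp only [pd]
      rw [fderiv_fun_sum fun k _ => (hg k).differentiable (by simp) y]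
      simp
    have h1 : ∀ j, pd j (lap (fun y => v y j)) x
        = ∑ i, pd i (pd i (pd j (fun y => v y j))) x := by
      intro j
      have := congrFun (hpd_sum j (fun i => pd i (pd i (fun y => v y j)))
        fun i => ((hv.component j).pd i).pd i) x
      refine this.trans (Finset.sum_congr rfl fun i _ => ?_)
      have hcomm : pd j (pd i fun y => v y j) = pd i (pd j fun y => v y j) :=
        funext fun z => pd_comm (hv.component j) j i z
      rw [pd_comm ((hv.component j).pd i) j i, hcomm]
    rw [Finset.sum_congr rfl fun j _ => h1 j, Finset.sum_comm]
    refine Finset.sum_eq_zero fun i _ => ?_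
    have h2 := hpd_sum i (fun j => pd j (fun y => v y j)) fun j => (hv.component j).pd j
    have h3 := hpd_sum i (fun j => pd i (pd j (fun y => v y j)))
      fun j => ((hv.component j).pd j).pd i
    have h0 : pd i (fun _ => 0) = fun _ => 0 := funext fun _ => by simp [pd]
    rw [← congrFun h3 x, ← h2, funext hdiv, h0, h0]
  have hint : ∀ j, ∫ x, pd j p x * lap (fun y => v y j) x
      = -∫ x, p x * pd j (lap (fun y => v y j)) x := fun j => by
    rw [integral_mul_pd hp ((hv.component j).lap.of_le (by exact_mod_cast le_top))
      (hvc.component j).lap, neg_neg]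
  have hi1 : ∀ j, Integrable (fun x => pd j p x * lap (fun y => v y j) x) := fun j =>
    ((continuous_pd hp j).mul (hv.component j).lap.continuous).integrable_of_hasCompactSupport
      (hvc.component j).lap.mul_left
  have hi2 : ∀ j, Integrable (fun x => p x * pd j (lap (fun y => v y j)) x) := fun j =>
    (hp.continuous.mul ((hv.component j).lap.pd j).continuous).integrable_of_hasCompactSupport
      ((hvc.component j).lap.pd j).mul_left
  rw [integral_finsetSum _ fun j _ => hi1 j, Finset.sum_congr rfl fun j _ => hint j,
    Finset.sum_neg_distrib, ← integral_finsetSum _ fun j _ => hi2 j]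
  simp [← Finset.mul_sum, hdivlap]

/-- The density `|v|^(r-3) ∑ᵢ (v · ∂ᵢv)²`, a multiple of `|∇ |v|^((r+1)/2)|²`. -/
def normGradDensity (r : ℝ) (v : E3 → E3) (x : E3) : ℝ :=
  ‖v x‖ ^ (r - 3) * ∑ i, (∑ j, v x j * pd i (fun y => v y j) x) ^ 2

lemma integral_sum_norm_rpow_mul_lap (hv : ContDiff ℝ (⊤ : ℕ∞) v) (hvc : HasCompactSupport v)
    {r : ℝ} (hr : 2 < r) :
    ∫ x, ∑ j, ‖v x‖ ^ (r - 1) * v x j * lap (fun y => v y j) x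
      = -∫ x, (‖v x‖ ^ (r - 1) * gradSq v x + (r - 1) * normGradDensity r v x) := by
  have h1 : ContDiff ℝ 1 v := hv.of_le (by exact_mod_cast le_top)
  have hn := contDiff_norm_comp_rpow h1 (q := r - 1) (by linarith)
  rw [integral_sum_mul_lap hv hvc (f := fun j x => ‖v x‖ ^ (r - 1) * v x j)
    fun j => hn.mul (h1.component j)]
  congr 2 with x
  have hpd : ∀ i j, pd i (fun x => ‖v x‖ ^ (r - 1) * v x j) x
      = ‖v x‖ ^ (r - 1) * pd i (fun y => v y j) x
        + v x j * ((r - 1) * ‖v x‖ ^ (r - 3) * ∑ k, v x k * pd i (fun y => v y k) x) := by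
    intro i j
    have := pd_norm_rpow (h1.differentiable one_ne_zero) (q := r - 1) (by linarith) i x
    rw [show r - 1 - 2 = r - 3 by ring] at this
    rw [← this]
    simp only [pd]
    rw [fderiv_fun_mul (hn.differentiable one_ne_zero x)
      ((h1.component j).differentiable one_ne_zero x)]
    simp
  simp only [hpd, gradSq, normGradDensity, Finset.mul_sum, ← Finset.sum_add_distrib]
  refine Finset.sum_congr rfl fun i _ => ?_
  simp only [Fin.sum_univ_three]
  ring

lemma continuous_gradSq (hv : ContDiff ℝ 1 v) : Continuous (gradSq v) :=
  continuous_finsetSum _ fun i _ => continuous_finsetSum _ fun j _ =>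
    (continuous_pd (hv.component j) i).pow 2

lemma continuous_normGradDensity (hv : ContDiff ℝ 1 v) {r : ℝ} (hr : 3 ≤ r) :
    Continuous (normGradDensity r v) :=
  (hv.continuous.norm.rpow_const fun _ => Or.inr (by linarith)).mul <|
    continuous_finsetSum _ fun i _ => (continuous_finsetSum _ fun j _ =>
      (hv.component j).continuous.mul (continuous_pd (hv.component j) i)).pow 2

lemma integrable_gradSq (hv : ContDiff ℝ 1 v) (hvc : HasCompactSupport v) :
    Integrable (gradSq v) := by
  refine (continuous_gradSq hv).integrable_of_hasCompactSupport
    (HasCompactSupport.intro hvc.isCompact fun x hx => ?_)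
  have hx0 : fderiv ℝ v x = 0 :=
    image_eq_zero_of_notMem_tsupport fun h => hx (tsupport_fderiv_subset ℝ h)
  simp [gradSq, pd_component (hv.differentiable one_ne_zero), hx0]

lemma hasCompactSupport_normGradDensity (hvc : HasCompactSupport v) (r : ℝ) :
    HasCompactSupport (normGradDensity r v) :=
  HasCompactSupport.intro hvc.isCompact fun x hx => by
    simp [normGradDensity, image_eq_zero_of_notMem_tsupport hx]

lemma norm_fderiv_sq_le_sum_pd_sq (g : E3 → ℝ) (x : E3) :
    ‖fderiv ℝ g x‖ ^ 2 ≤ ∑ i, pd i g x ^ 2 := by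
  rw [← Real.le_sqrt (norm_nonneg _) (by positivity)]
  refine (fderiv ℝ g x).opNorm_le_bound (Real.sqrt_nonneg _) fun z => ?_
  have hz : fderiv ℝ g x z = ∑ i, pd i g x * z i := by
    conv_lhs => rw [← (EuclideanSpace.basisFun (Fin 3) ℝ).sum_repr z]
    simp [pd, mul_comm]
  rw [hz, EuclideanSpace.norm_eq, ← Real.sqrt_mul (by positivity)]
  refine Real.abs_le_sqrt ?_
  simpa using Finset.sum_mul_sq_le_sq_mul_sq Finset.univ (fun i => pd i g x) (fun i => z i)

lemma sum_pd_norm_rpow_sq (hv : Differentiable ℝ v) {r : ℝ} (hr : 1 < r) (x : E3) :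
    ∑ i, pd i (fun y => ‖v y‖ ^ ((r + 1) / 2)) x ^ 2
      = ((r + 1) / 2) ^ 2 * normGradDensity r v x := by
  have hpow : (‖v x‖ ^ ((r + 1) / 2 - 2)) ^ 2 = ‖v x‖ ^ (r - 3) := by
    rw [← Real.rpow_mul_natCast (norm_nonneg _)]
    norm_num
    ring_nf
  rw [normGradDensity, ← hpow, Finset.mul_sum, Finset.mul_sum]
  refine Finset.sum_congr rfl fun i _ => ?_
  rw [pd_norm_rpow hv (by linarith)]
  ring

/-- Sobolev's inequality on ℝ³ applied to `|v|^((r+1)/2)`. -/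
lemma exists_sobolev_norm_rpow {r : ℝ} (hr : 3 ≤ r) :
    ∃ c : ℝ, 0 < c ∧ ∀ v : E3 → E3, ContDiff ℝ 1 v → HasCompactSupport v →
      (∫ x, ‖v x‖ ^ (3 * (r + 1))) ^ ((1 : ℝ) / 3) ≤ c * ∫ x, normGradDensity r v x := by
  set κ : ℝ := (SNormLESNormFDerivOfEqConst ℝ (volume : Measure E3) 2 : ℝ)
  refine ⟨κ ^ 2 * ((r + 1) / 2) ^ 2 + 1, by positivity, fun v hv hvc => ?_⟩
  set g : E3 → ℝ := fun x => ‖v x‖ ^ ((r + 1) / 2) with hg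
  have hgd : ContDiff ℝ 1 g := contDiff_norm_comp_rpow hv (by linarith)
  have hgc : HasCompactSupport g := hvc.comp_left (g := fun z : E3 => ‖z‖ ^ ((r + 1) / 2)) (by
    simp [Real.zero_rpow (show (r + 1) / 2 ≠ 0 by linarith)])
  have hsob := eLpNorm_le_eLpNorm_fderiv_of_eq (volume : Measure E3) hgd hgc (p := 2) (p' := 6)
    (by norm_num) (by simp) (by simp; norm_num)
  have hS0 : ∀ x, 0 ≤ normGradDensity r v x := fun x => by unfold normGradDensity; positivity
  have hSi : Integrable (normGradDensity r v) :=
    (continuous_normGradDensity hv hr).integrable_of_hasCompactSupport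
      (hasCompactSupport_normGradDensity hvc r)
  have hfc := hgd.continuous_fderiv one_ne_zero
  have hm2 : MemLp (fderiv ℝ g) 2 := hfc.memLp_of_hasCompactSupport (hgc.fderiv ℝ)
  have hm6 : MemLp g 6 := hgd.continuous.memLp_of_hasCompactSupport hgc
  simp only [NNReal.coe_ofNat, ENNReal.coe_ofNat] at hsob
  rw [hm2.eLpNorm_eq_integral_rpow_norm (by simp) (by simp),
    hm6.eLpNorm_eq_integral_rpow_norm (by simp) (by simp)] at hsob
  simp only [ENNReal.toReal_ofNat, Real.rpow_ofNat] at hsob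
  have hA0 : 0 ≤ ∫ x, ‖g x‖ ^ 6 := integral_nonneg fun x => by positivity
  have hB0 : 0 ≤ ∫ x, ‖fderiv ℝ g x‖ ^ 2 := integral_nonneg fun x => by positivity
  have hsob' : (∫ x, ‖g x‖ ^ 6) ^ ((6 : ℝ)⁻¹) ≤ κ * (∫ x, ‖fderiv ℝ g x‖ ^ 2) ^ ((2 : ℝ)⁻¹) := by
    have := ENNReal.toReal_mono (by finiteness) hsob
    rwa [ENNReal.toReal_mul, ENNReal.toReal_ofReal (by positivity),
      ENNReal.toReal_ofReal (by positivity), ENNReal.coe_toReal] at this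
  have hsq := pow_le_pow_left₀ (by positivity) hsob' 2
  rw [mul_pow, ← Real.rpow_mul_natCast hA0, ← Real.rpow_mul_natCast hB0] at hsq
  norm_num at hsq
  have hgA : ∀ x, ‖v x‖ ^ (3 * (r + 1)) = g x ^ 6 := fun x => by
    rw [hg, ← Real.rpow_mul_natCast (norm_nonneg _)]
    norm_num
    ring_nf
  have hgB : ∫ x, ‖fderiv ℝ g x‖ ^ 2 ≤ ((r + 1) / 2) ^ 2 * ∫ x, normGradDensity r v x := by
    rw [← integral_const_mul]
    exact integral_mono (hm2.integrable_norm_pow two_ne_zero)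
      (hSi.const_mul _) fun x => (norm_fderiv_sq_le_sum_pd_sq g x).trans
        (sum_pd_norm_rpow_sq (hv.differentiable one_ne_zero) (by linarith) x).le
  simp only [hgA]
  have hS : 0 ≤ ∫ x, normGradDensity r v x := integral_nonneg hS0
  calc (∫ x, g x ^ 6) ^ ((1 : ℝ) / 3) ≤ κ ^ 2 * ∫ x, ‖fderiv ℝ g x‖ ^ 2 := by
        simpa [(show Even 6 by decide).pow_abs] using hsq
    _ ≤ κ ^ 2 * (((r + 1) / 2) ^ 2 * ∫ x, normGradDensity r v x) := by gcongr
    _ ≤ _ := by nlinarith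

end VectorField

/-- The time derivative of `∫ |∇u|²`. -/
lemma hasDerivAt_integral_gradSq {u : ℝ → E3 → E3}
    (hu : ContDiff ℝ (⊤ : ℕ∞) (fun q : ℝ × E3 => u q.1 q.2))
    (hsupp : ∀ a b : ℝ, ∃ K : Set E3, IsCompact K ∧
      ∀ t ∈ Set.Icc a b, ∀ x : E3, x ∉ K → u t x = 0) (t : ℝ) :
    HasDerivAt (fun s => ∫ x, gradSq (u s) x)
      (-2 * ∫ x, ∑ j, deriv (fun s => u s x j) t * lap (fun y => u t y j) x) t := by
  have hU : ∀ j : Fin 3, ContDiff ℝ (⊤ : ℕ∞) (fun q : ℝ × E3 => u q.1 q.2 j) := fun j =>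
    (EuclideanSpace.proj (𝕜 := ℝ) j).contDiff.comp hu
  have hslice : ∀ s, ContDiff ℝ (⊤ : ℕ∞) (u s) := fun s =>
    hu.comp (contDiff_prodMk_right s)
  have hpd : ∀ {h : ℝ × E3 → ℝ}, ContDiff ℝ (⊤ : ℕ∞) h → ∀ i s x,
      pd i (fun y => h (s, y)) x = fderiv ℝ h (s, x) (0, EuclideanSpace.single i 1) := by
    intro h hh i s x
    have := (hh.differentiable (by simp) (s, x)).hasFDerivAt.comp x (hasFDerivAt_prodMk_right s x)
    exact congrArg (fun L : E3 →L[ℝ] ℝ => L (EuclideanSpace.single i 1)) this.fderiv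
  have hdt : ∀ {h : ℝ × E3 → ℝ}, ContDiff ℝ (⊤ : ℕ∞) h → ∀ s x,
      HasDerivAt (fun s => h (s, x)) (fderiv ℝ h (s, x) (1, 0)) s := fun hh =>
    hasDerivAt_slice (hh.differentiable (by simp))
  set P : Fin 3 → Fin 3 → ℝ × E3 → ℝ := fun i j q =>
    fderiv ℝ (fun q : ℝ × E3 => u q.1 q.2 j) q (0, EuclideanSpace.single i 1) with hP
  have hPd : ∀ i j, ContDiff ℝ (⊤ : ℕ∞) (P i j) := fun i j => contDiff_fderiv_apply_const (hU j) _
  set F : ℝ × E3 → ℝ := fun q => ∑ i, ∑ j, P i j q ^ 2 with hF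
  have hFd : ContDiff ℝ (⊤ : ℕ∞) F :=
    ContDiff.sum fun i _ => ContDiff.sum fun j _ => (hPd i j).pow 2
  have hgrad : ∀ s x, gradSq (u s) x = F (s, x) := fun s x => by
    simp only [gradSq, hF, hP, ← hpd (hU _)]
  obtain ⟨K, hK, hKu⟩ := hsupp (t - 1) (t + 1)
  have hFK : ∀ s ∈ Set.Icc (t - 1) (t + 1), ∀ x ∉ K, F (s, x) = 0 := by
    intro s hs x hx
    have h0 : fderiv ℝ (u s) x = 0 := by
      have : u s =ᶠ[nhds x] fun _ => 0 := by
        filter_upwards [hK.isClosed.isOpen_compl.mem_nhds hx] with z hz using hKu s hs z hz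
      rw [this.fderiv_eq]
      simp
    rw [← hgrad, gradSq]
    simp [pd_component ((hslice s).differentiable (by simp)), h0]
  have ht : t ∈ Set.Icc (t - 1) (t + 1) := by constructor <;> linarith
  have hmain := hasDerivAt_integral_of_contDiff (m := (volume : Measure E3))
    (hFd.of_le (by exact_mod_cast le_top)) hK hFK
  simp only [← hgrad] at hmain
  convert hmain using 1
  have hw : ∀ j x, deriv (fun s => u s x j) t
      = fderiv ℝ (fun q : ℝ × E3 => u q.1 q.2 j) (t, x) (1, 0) := fun j x => (hdt (hU j) t x).deriv
  have hwd : ∀ j, ContDiff ℝ (⊤ : ℕ∞)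
      (fun q => fderiv ℝ (fun q : ℝ × E3 => u q.1 q.2 j) q (1, 0)) := fun j =>
    contDiff_fderiv_apply_const (hU j) _
  simp only [hw]
  rw [integral_sum_mul_lap (hslice t) (HasCompactSupport.intro hK (hKu t ht))
    (f := fun j x => fderiv ℝ (fun q : ℝ × E3 => u q.1 q.2 j) (t, x) (1, 0))
    (fun j => ((hwd j).comp (contDiff_prodMk_right t)).of_le (by exact_mod_cast le_top)),
    mul_neg, neg_mul, neg_neg, ← integral_const_mul]
  congr 1 with x
  have hdF : HasDerivAt (fun s => F (s, x)) (∑ i, ∑ j, 2 * P i j (t, x) *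
      fderiv ℝ (P i j) (t, x) (1, 0)) t := by
    refine HasDerivAt.fun_sum fun i _ => HasDerivAt.fun_sum fun j _ => ?_
    simpa using (hdt (hPd i j) t x).fun_pow 2
  rw [← hdF.unique (hdt hFd t x), Finset.mul_sum]
  refine Finset.sum_congr rfl fun i _ => ?_
  rw [Finset.mul_sum]
  refine Finset.sum_congr rfl fun j _ => ?_
  rw [hpd (hwd j), hpd (hU j), fderiv_fderiv_apply_comm (hU j)]
  simp only [hP]
  ring

/-- The convective term is absorbed by the damping term, using `1 ≤ 2βμ` in the critical case. -/
lemma exists_sq_div_le_rpow_add {μ β r : ℝ} (hμ : 0 < μ) (hβ : 0 < β) (hr : 3 ≤ r)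
    (hr3 : r = 3 → 1 ≤ 2 * β * μ) :
    ∃ c : ℝ, 0 ≤ c ∧ ∀ s : ℝ, 0 ≤ s → s ^ 2 / μ ≤ 2 * β * s ^ (r - 1) + c := by
  rcases hr.eq_or_lt with rfl | hr
  · refine ⟨0, le_rfl, fun s _ => ?_⟩
    rw [show (3 : ℝ) - 1 = (2 : ℕ) by norm_num, Real.rpow_natCast, div_le_iff₀ hμ]
    nlinarith [hr3 rfl, sq_nonneg s]
  · have hb : 0 ≤ (2 * β * μ)⁻¹ := by positivity
    set m : ℝ := (2 * β * μ)⁻¹ ^ (r - 3)⁻¹ with hm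
    have hm0 : 0 ≤ m := by positivity
    refine ⟨m ^ 2 / μ, by positivity, fun s hs => ?_⟩
    rcases le_total s m with hsm | hsm
    · have h1 : s ^ 2 / μ ≤ m ^ 2 / μ := by gcongr
      have h2 : 0 ≤ 2 * β * s ^ (r - 1) := by positivity
      linarith
    · have h1 : (2 * β * μ)⁻¹ ≤ s ^ (r - 3) := by
        have := Real.rpow_le_rpow hm0 hsm (by linarith : 0 ≤ r - 3)
        rwa [hm, Real.rpow_inv_rpow hb (by linarith)] at this
      have h2 : s ^ (r - 1) = s ^ (r - 3) * s ^ 2 := by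
        rw [show r - 1 = (r - 3) + (2 : ℕ) by push_cast; ring,
          Real.rpow_add_natCast' hs (by push_cast; linarith)]
      have h3 : s ^ 2 / μ ≤ 2 * β * s ^ (r - 1) := by
        calc s ^ 2 / μ = 2 * β * ((2 * β * μ)⁻¹ * s ^ 2) := by field_simp
          _ ≤ 2 * β * s ^ (r - 1) := by rw [h2]; gcongr
      have : 0 ≤ m ^ 2 / μ := by positivity
      linarith

lemma two_mul_mul_mul_le {μ : ℝ} (hμ : 0 < μ) (e c l : ℝ) :
    2 * e * (c * l) ≤ μ * l ^ 2 + e ^ 2 / μ * c ^ 2 := by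
  have h : μ * l ^ 2 + e ^ 2 / μ * c ^ 2 - 2 * e * (c * l) = (μ * l - e * c) ^ 2 / μ := by
    field_simp
    ring
  have : 0 ≤ (μ * l - e * c) ^ 2 / μ := by positivity
  linarith

/-- The equation tested with `-2 l`, with the convective and the forcing terms absorbed by the
viscous one. -/
lemma neg_two_mul_sum_mul_le {ι : Type*} [Fintype ι] {μ α b e e' k n : ℝ} (hμ : 0 < μ)
    {w l a P F : ι → ℝ} {d : ι → ι → ℝ}
    (heq : ∀ j, w j - μ * l j + e * (∑ i, a i * d i j) + α * a j + b * (n * a j)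
      = -(e' * P j) + e' * F j + k * a j) :
    -2 * ∑ j, w j * l j ≤ 2 * (α - k) * (∑ j, a j * l j) + 2 * b * (∑ j, n * a j * l j)
      + 2 * e' * (∑ j, P j * l j) + e ^ 2 / μ * ((∑ i, a i ^ 2) * ∑ i, ∑ j, d i j ^ 2)
      + e' ^ 2 / μ * ∑ j, F j ^ 2 := by
  have hcs : (∑ j, (∑ i, a i * d i j) ^ 2) ≤ (∑ i, a i ^ 2) * ∑ i, ∑ j, d i j ^ 2 := by
    rw [Finset.sum_comm (f := fun i j => d i j ^ 2), Finset.mul_sum]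
    exact Finset.sum_le_sum fun j _ => Finset.sum_mul_sq_le_sq_mul_sq _ _ _
  have hj : ∀ j, -2 * (w j * l j) ≤ 2 * (α - k) * (a j * l j) + 2 * b * (n * a j * l j)
      + 2 * e' * (P j * l j) + e ^ 2 / μ * (∑ i, a i * d i j) ^ 2 + e' ^ 2 / μ * F j ^ 2 := by
    intro j
    have h1 := two_mul_mul_mul_le hμ e (∑ i, a i * d i j) (l j)
    have h2 := two_mul_mul_mul_le hμ e' (-F j) (l j)
    have h3 : w j = μ * l j - e * (∑ i, a i * d i j) - α * a j - b * (n * a j)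
        - e' * P j + e' * F j + k * a j := by linarith [heq j]
    rw [h3]
    linarith
  have hsum := Finset.sum_le_sum fun j (_ : j ∈ Finset.univ) => hj j
  simp only [Finset.sum_add_distrib, ← Finset.mul_sum] at hsum
  have := mul_le_mul_of_nonneg_left hcs (by positivity : 0 ≤ e ^ 2 / μ)
  linarith

/-- The gradient energy estimate at a fixed time, for a field `v` with time derivative `w`. -/
lemma integral_neg_two_mul_lap_le {μ α β r c k e e' E : ℝ} (hμ : 0 < μ) (hr : 3 ≤ r)
    (he : 0 ≤ e) (hE : E = e ^ (r - 1))
    (hc : ∀ s : ℝ, 0 ≤ s → s ^ 2 / μ ≤ 2 * β * s ^ (r - 1) + c)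
    {v f : E3 → E3} {w : Fin 3 → E3 → ℝ} {p : E3 → ℝ}
    (hv : ContDiff ℝ (⊤ : ℕ∞) v) (hvc : HasCompactSupport v)
    (hdiv : ∀ x, ∑ i, pd i (fun y => v y i) x = 0) (hp : ContDiff ℝ 1 p)
    (hf : Integrable fun x => ‖f x‖ ^ 2) (hw : ∀ j, Continuous (w j))
    (heq : ∀ x j, w j x - μ * lap (fun y => v y j) x
      + e * (∑ i, v x i * pd i (fun y => v y j) x) + α * v x j
      + β * E * (‖v x‖ ^ (r - 1) * v x j) = -(e' * pd j p x) + e' * f x j + k * v x j) :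
    -2 * (∫ x, ∑ j, w j x * lap (fun y => v y j) x) + 2 * (α - k) * (∫ x, gradSq v x)
        + 2 * β * E * (r - 1) * ∫ x, normGradDensity r v x
      ≤ c * (∫ x, gradSq v x) + e' ^ 2 / μ * ∫ x, ‖f x‖ ^ 2 := by
  have h1 : ContDiff ℝ 1 v := hv.of_le (by exact_mod_cast le_top)
  have hlap : ∀ {g : Fin 3 → E3 → ℝ}, (∀ j, Continuous (g j)) →
      Integrable fun x => ∑ j, g j x * lap (fun y => v y j) x := fun hg =>
    integrable_finsetSum _ fun j _ => ((hg j).mul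
      (hv.component j).lap.continuous).integrable_of_hasCompactSupport
      (hvc.component j).lap.mul_left
  have hn : Continuous fun x => ‖v x‖ ^ (r - 1) :=
    (contDiff_norm_comp_rpow h1 (by linarith)).continuous
  have hG := integrable_gradSq h1 hvc
  have hN : Integrable fun x => ‖v x‖ ^ (r - 1) * gradSq v x := by
    refine (hn.mul (continuous_gradSq h1)).integrable_of_hasCompactSupport
      (HasCompactSupport.intro hvc.isCompact fun x hx => ?_)
    simp [image_eq_zero_of_notMem_tsupport hx, Real.zero_rpow (show r - 1 ≠ 0 by linarith)]
  have hS : Integrable (normGradDensity r v) :=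
    (continuous_normGradDensity h1 hr).integrable_of_hasCompactSupport
      (hasCompactSupport_normGradDensity hvc r)
  have iw := (hlap hw).const_mul (-2)
  have iv := (hlap fun j => (h1.component j).continuous).const_mul (2 * (α - k))
  have idamp : Integrable fun x =>
      2 * (β * E) * ∑ j, ‖v x‖ ^ (r - 1) * v x j * lap (fun y => v y j) x :=
    (hlap fun j => hn.mul (h1.component j).continuous).const_mul (2 * (β * E))
  have ip := (hlap fun j => continuous_pd hp j).const_mul (2 * e')
  have iN := hN.const_mul (2 * (β * E))
  have iG := hG.const_mul c
  have iF := hf.const_mul (e' ^ 2 / μ)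
  have hpt : ∀ x, -2 * ∑ j, w j x * lap (fun y => v y j) x ≤
      2 * (α - k) * (∑ j, v x j * lap (fun y => v y j) x)
      + 2 * (β * E) * (∑ j, ‖v x‖ ^ (r - 1) * v x j * lap (fun y => v y j) x)
      + 2 * e' * (∑ j, pd j p x * lap (fun y => v y j) x)
      + 2 * (β * E) * (‖v x‖ ^ (r - 1) * gradSq v x) + c * gradSq v x
      + e' ^ 2 / μ * ‖f x‖ ^ 2 := by
    intro x
    have h := neg_two_mul_sum_mul_le (d := fun i j => pd i (fun y => v y j) x) hμ (heq x)
    have hnorm : ∀ z : E3, ∑ j, z j ^ 2 = ‖z‖ ^ 2 := fun z => by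
      simp [EuclideanSpace.norm_sq_eq]
    rw [hnorm, hnorm] at h
    have habs := hc (e * ‖v x‖) (by positivity)
    rw [Real.mul_rpow he (norm_nonneg _), ← hE] at habs
    have hg0 : 0 ≤ gradSq v x := by unfold gradSq; positivity
    have h2 := mul_le_mul_of_nonneg_right habs hg0
    have h3 : e ^ 2 / μ * (‖v x‖ ^ 2 * gradSq v x) = (e * ‖v x‖) ^ 2 / μ * gradSq v x := by ring
    rw [show ∑ i, ∑ j, pd i (fun y => v y j) x ^ 2 = gradSq v x from rfl] at h
    linarith
  have hint := integral_mono iw (((((iv.add idamp).add ip).add iN).add iG).add iF) hpt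
  have hd := integral_sum_norm_rpow_mul_lap hv hvc (r := r) (by linarith)
  rw [integral_add hN (hS.const_mul _), integral_const_mul] at hd
  rw [integral_add' ((((iv.add idamp).add ip).add iN).add iG) iF,
    integral_add' (((iv.add idamp).add ip).add iN) iG, integral_add' ((iv.add idamp).add ip) iN,
    integral_add' (iv.add idamp) ip, integral_add' iv idamp] at hint
  simp only [integral_const_mul] at hint
  rw [integral_sum_self_mul_lap hv hvc, integral_sum_pd_mul_lap hv hvc hdiv hp, hd] at hint
  linarith

/-- Second (gradient) energy inequality (3.6) of Lemma 3.1, for classical spatially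
compactly supported solutions of the transformed 3D stochastic CBF equations with
linear multiplicative noise (`r ≥ 3`, and `2βμ ≥ 1` if `r = 3`):
`G′(t) + (α − 2σy(t))G(t) + C* e^{(r−1)y(t)} ‖u(t)‖_{L^{3(r+1)}}^{r+1}
  ≤ C G(t) + C e^{2|y(t)|} ∫|f|² dx`, where `G(t) = ∫|∇u(t)|² dx`. -/
theorem stmt15 (μ α β σ r : ℝ) (hμ : 0 < μ) (hα : 0 < α) (hβ : 0 < β) (hσ : 0 < σ)
    (hr : 3 ≤ r) (hr3 : r = 3 → 1 ≤ 2 * β * μ) :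
    ∃ C Cstar : ℝ, 0 < C ∧ 0 < Cstar ∧
      ∀ (y : ℝ → ℝ), Continuous y →
      ∀ (f : ℝ → E3 → E3), Continuous (Function.uncurry f) →
        (∀ t, Integrable (fun x : E3 => ‖f t x‖ ^ 2)) →
      ∀ (u : ℝ → E3 → E3),
        ContDiff ℝ (⊤ : ℕ∞) (fun q : ℝ × E3 => u q.1 q.2) →
        (∀ a b : ℝ, ∃ K : Set E3, IsCompact K ∧
          ∀ t ∈ Set.Icc a b, ∀ x : E3, x ∉ K → u t x = 0) →
        (∀ t x, (∑ i : Fin 3, pd i (fun y' => u t y' i) x) = 0) →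
      ∀ (p : ℝ → E3 → ℝ), (∀ t, ContDiff ℝ 1 (p t)) →
        (∀ (t : ℝ) (x : E3) (j : Fin 3),
          deriv (fun s => u s x j) t - μ * lap (fun y' => u t y' j) x
            + Real.exp (y t) * (∑ i : Fin 3, u t x i * pd i (fun y' => u t y' j) x)
            + α * u t x j
            + β * Real.exp ((r - 1) * y t) * (‖u t x‖ ^ (r - 1) * u t x j)
          = -(Real.exp (-(y t)) * pd j (p t) x) + Real.exp (-(y t)) * f t x j
            + σ * y t * u t x j) →
      (∀ t : ℝ, DifferentiableAt ℝ (fun s => ∫ x : E3, gradSq (u s) x) t) ∧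
      ∀ t : ℝ,
        deriv (fun s => ∫ x : E3, gradSq (u s) x) t
          + (α - 2 * σ * y t) * (∫ x : E3, gradSq (u t) x)
          + Cstar * Real.exp ((r - 1) * y t) *
              (∫ x : E3, ‖u t x‖ ^ (3 * (r + 1))) ^ ((1 : ℝ) / 3)
        ≤ C * (∫ x : E3, gradSq (u t) x)
          + C * Real.exp (2 * |y t|) * ∫ x : E3, ‖f t x‖ ^ 2 := by
  obtain ⟨c, hc0, hc⟩ := exists_sq_div_le_rpow_add hμ hβ hr hr3
  obtain ⟨κ, hκ, hsob⟩ := exists_sobolev_norm_rpow hr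
  refine ⟨c + 1 / μ, 2 * β * (r - 1) / κ, by positivity,
    div_pos (mul_pos (by positivity) (by linarith)) hκ, ?_⟩
  intro y _ f _ hfi u hu hsupp hdiv p hp heq
  have hder := hasDerivAt_integral_gradSq hu hsupp
  refine ⟨fun t => (hder t).differentiableAt, fun t => ?_⟩
  rw [(hder t).deriv]
  obtain ⟨K, hK, hKu⟩ := hsupp t t
  have hv : ContDiff ℝ (⊤ : ℕ∞) (u t) := hu.comp (contDiff_prodMk_right t)
  have hvc : HasCompactSupport (u t) := HasCompactSupport.intro hK (hKu t (by simp))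
  have hw : ∀ j : Fin 3, Continuous fun x => deriv (fun s => u s x j) t := by
    intro j
    have hU : ContDiff ℝ (⊤ : ℕ∞) (fun q : ℝ × E3 => u q.1 q.2 j) :=
      (EuclideanSpace.proj (𝕜 := ℝ) j).contDiff.comp hu
    have heq' : ∀ x, deriv (fun s => u s x j) t
        = fderiv ℝ (fun q : ℝ × E3 => u q.1 q.2 j) (t, x) (1, 0) := fun x =>
      (hasDerivAt_slice (hU.differentiable (by simp)) t x).deriv
    simp only [heq']
    exact (contDiff_fderiv_apply_const hU _).continuous.comp (by fun_prop)
  have hE : Real.exp ((r - 1) * y t) = Real.exp (y t) ^ (r - 1) := by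
    rw [← Real.exp_mul, mul_comm]
  have hmain := integral_neg_two_mul_lap_le (β := β) hμ hr (Real.exp_pos (y t)).le hE hc hv hvc
    (hdiv t) (hp t) (hfi t) hw (heq t)
  have hS := hsob (u t) (hv.of_le (by exact_mod_cast le_top)) hvc
  have hG0 : 0 ≤ ∫ x, gradSq (u t) x := integral_nonneg fun x => by
    unfold gradSq; positivity
  have hF0 : 0 ≤ ∫ x, ‖f t x‖ ^ 2 := integral_nonneg fun x => by positivity
  have hexp : Real.exp (-(y t)) ^ 2 ≤ Real.exp (2 * |y t|) := by
    rw [← Real.exp_nat_mul]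
    exact Real.exp_le_exp.2 (by push_cast; linarith [neg_abs_le (y t)])
  have hdamp : 2 * β * (r - 1) / κ * Real.exp ((r - 1) * y t) *
      (∫ x, ‖u t x‖ ^ (3 * (r + 1))) ^ ((1 : ℝ) / 3)
      ≤ 2 * β * Real.exp ((r - 1) * y t) * (r - 1) * ∫ x, normGradDensity r (u t) x := by
    have hr1 : 0 < r - 1 := by linarith
    calc _ ≤ 2 * β * (r - 1) / κ * Real.exp ((r - 1) * y t) *
          (κ * ∫ x, normGradDensity r (u t) x) := by gcongr
      _ = _ := by field_simp
  have hforce : Real.exp (-(y t)) ^ 2 / μ * ∫ x, ‖f t x‖ ^ 2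
      ≤ (c + 1 / μ) * Real.exp (2 * |y t|) * ∫ x, ‖f t x‖ ^ 2 := by
    refine mul_le_mul_of_nonneg_right ?_ hF0
    calc Real.exp (-(y t)) ^ 2 / μ ≤ Real.exp (2 * |y t|) / μ := by gcongr
      _ = 1 / μ * Real.exp (2 * |y t|) := by ring
      _ ≤ _ := by gcongr; linarith
  have hGμ : 0 ≤ 1 / μ * ∫ x, gradSq (u t) x := by positivity
  have hGα := mul_nonneg hα.le hG0
  linarith

end
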